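/- arXiv:2501.11032 — 2 statements merged into one kernel-verified Lean document; each statement's English description precedes it below -/
import Mathlib

section
/- Let X be a vector space over a field 𝕂 with linear subspaces W₁ ⊆ W₂ and λ, μ. For each linear subspace V set R(V) := ((V ∩ W₂) + W₁)/W₁, a subspace of W₂/W₁. Then: (a) there are linear isomorphisms (R(λ) ∩ R(μ))/R(λ ∩ μ) ≅ ((λ + (μ ∩ W₂)) ∩ W₁)/((λ ∩ W₁) + (μ ∩ W₁)) and R(λ ∩ μ) ≅ (λ ∩ μ ∩ W₂)/(λ ∩ μ ∩ W₁); moreover R(λ ∩ μ) = R(λ) ∩ R(μ) whenever W₁ ⊆ μ ⊆ W₂; (b) there are linear isomorphisms R(λ + μ)/(R(λ) + R(μ)) ≅ (((λ + μ) ∩ W₂) + W₁)/((λ ∩ W₂) + (μ ∩ W₂) + W₁) and R(W₂)/R(λ + μ) ≅ (λ + μ + W₂)/(λ + μ + W₁); moreover R(λ + μ) = R(λ) + R(μ) whenever W₁ ⊆ μ ⊆ W₂. -/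
/-- For subspaces `W₁ ⊆ W₂` of `X`, the reduction `R(V) := ((V ∩ W₂) + W₁)/W₁`,
viewed as a subspace of `X/W₁` (it is contained in `W₂/W₁`). -/
def redR {𝕂 : Type*} [Field 𝕂] {X : Type*} [AddCommGroup X] [Module 𝕂 X]
    (W₁ W₂ V : Submodule 𝕂 X) : Submodule 𝕂 (X ⧸ W₁) :=
  ((V ⊓ W₂) ⊔ W₁).map W₁.mkQ

/-- Two subquotients `A/A'` and `B/B'` are isomorphic as soon as some module maps onto both of
them with the same kernel. -/
theorem nonempty_subquotient_equiv {R P Y Z : Type*} [Ring R] [AddCommGroup P] [Module R P]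
    [AddCommGroup Y] [Module R Y] [AddCommGroup Z] [Module R Z]
    (f : P →ₗ[R] Y) (g : P →ₗ[R] Z) {A A' : Submodule R Y} {B B' : Submodule R Z}
    (hf : ∀ p, f p ∈ A) (hg : ∀ p, g p ∈ B)
    (hfs : ∀ a ∈ A, ∃ p, f p - a ∈ A') (hgs : ∀ b ∈ B, ∃ p, g p - b ∈ B')
    (hfg : ∀ p, f p ∈ A' ↔ g p ∈ B') :
    Nonempty ((A ⧸ A'.comap A.subtype) ≃ₗ[R] (B ⧸ B'.comap B.subtype)) := by
  let φ := (A'.comap A.subtype).mkQ ∘ₗ f.codRestrict A hf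
  let ψ := (B'.comap B.subtype).mkQ ∘ₗ g.codRestrict B hg
  have hφ : Function.Surjective φ := by
    intro y
    obtain ⟨⟨a, ha⟩, rfl⟩ := Submodule.mkQ_surjective _ y
    obtain ⟨p, hp⟩ := hfs a ha
    exact ⟨p, (Submodule.Quotient.eq _).2 hp⟩
  have hψ : Function.Surjective ψ := by
    intro y
    obtain ⟨⟨b, hb⟩, rfl⟩ := Submodule.mkQ_surjective _ y
    obtain ⟨p, hp⟩ := hgs b hb
    exact ⟨p, (Submodule.Quotient.eq _).2 hp⟩
  have hker : LinearMap.ker φ = LinearMap.ker ψ := by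
    ext p
    simpa [φ, ψ] using hfg p
  exact ⟨(φ.quotKerEquivOfSurjective hφ).symm ≪≫ₗ Submodule.quotEquivOfEq _ _ hker ≪≫ₗ
    ψ.quotKerEquivOfSurjective hψ⟩

section redR

variable {𝕂 : Type*} [Field 𝕂] {X : Type*} [AddCommGroup X] [Module 𝕂 X]

theorem mkQ_mem_redR {W₁ W₂ V : Submodule 𝕂 X} {x : X} :
    W₁.mkQ x ∈ redR W₁ W₂ V ↔ x ∈ (V ⊓ W₂) ⊔ W₁ := by
  rw [redR, ← Submodule.mem_comap, Submodule.comap_map_mkQ, sup_comm W₁, sup_assoc, sup_idem]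

theorem redR_eq_map (W₁ W₂ V : Submodule 𝕂 X) : redR W₁ W₂ V = (V ⊓ W₂).map W₁.mkQ := by
  rw [redR, Submodule.map_sup, Submodule.mkQ_map_self, sup_bot_eq]

theorem redR_mono (W₁ W₂ : Submodule 𝕂 X) : Monotone (redR W₁ W₂) := fun _ _ h =>
  Submodule.map_mono (sup_le_sup_right (inf_le_inf_right _ h) _)

theorem mkQ_mem_redR_of_mem {W₁ W₂ V : Submodule 𝕂 X} {x : X} (hV : x ∈ V) (hW : x ∈ W₂) :
    W₁.mkQ x ∈ redR W₁ W₂ V :=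
  mkQ_mem_redR.2 (Submodule.mem_sup_left ⟨hV, hW⟩)

theorem exists_mkQ_eq_of_mem_redR {W₁ W₂ V : Submodule 𝕂 X} {y : X ⧸ W₁}
    (hy : y ∈ redR W₁ W₂ V) : ∃ x ∈ V, x ∈ W₂ ∧ W₁.mkQ x = y := by
  rw [redR_eq_map] at hy
  obtain ⟨x, hx, rfl⟩ := hy
  exact ⟨x, hx.1, hx.2, rfl⟩

theorem redR_inf_of_le {W₁ W₂ m : Submodule 𝕂 X} (l : Submodule 𝕂 X) (hm : W₁ ≤ m) :
    redR W₁ W₂ (l ⊓ m) = redR W₁ W₂ l ⊓ redR W₁ W₂ m := by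
  refine le_antisymm ((redR_mono W₁ W₂).map_inf_le l m) ?_
  rintro y ⟨hl, hy⟩
  obtain ⟨a, hal, haW, rfl⟩ := exists_mkQ_eq_of_mem_redR hl
  have ham : a ∈ m := sup_le inf_le_left hm (mkQ_mem_redR.1 hy)
  exact mkQ_mem_redR_of_mem ⟨hal, ham⟩ haW

theorem redR_sup_of_le {W₁ W₂ m : Submodule 𝕂 X} (l : Submodule 𝕂 X) (hm : m ≤ W₂) :
    redR W₁ W₂ (l ⊔ m) = redR W₁ W₂ l ⊔ redR W₁ W₂ m := by
  rw [redR_eq_map, redR_eq_map, redR_eq_map, ← Submodule.map_sup, inf_eq_left.2 hm, sup_comm l,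
    sup_inf_assoc_of_le l hm, sup_comm]

theorem redR_inf_quotient_equiv {W₁ W₂ : Submodule 𝕂 X} (l m : Submodule 𝕂 X) (hW : W₁ ≤ W₂) :
    Nonempty
      ((↥(redR W₁ W₂ l ⊓ redR W₁ W₂ m) ⧸
          (redR W₁ W₂ (l ⊓ m)).comap (redR W₁ W₂ l ⊓ redR W₁ W₂ m).subtype) ≃ₗ[𝕂]
        (↥((l ⊔ (m ⊓ W₂)) ⊓ W₁) ⧸
          ((l ⊓ W₁) ⊔ (m ⊓ W₁)).comap ((l ⊔ (m ⊓ W₂)) ⊓ W₁).subtype)) := by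
  -- Pairs `(a, b)` with `a ∈ l ∩ W₂`, `b ∈ m ∩ W₂` and `a + b ∈ W₁` map to `[a]` and to `a + b`.
  let s : X × X →ₗ[𝕂] X := LinearMap.coprod LinearMap.id LinearMap.id
  let P : Submodule 𝕂 (X × X) := (l ⊓ W₂).prod (m ⊓ W₂) ⊓ W₁.comap s
  refine nonempty_subquotient_equiv (P := P) (W₁.mkQ ∘ₗ LinearMap.fst 𝕂 X X ∘ₗ P.subtype)
    (s ∘ₗ P.subtype) ?_ ?_ ?_ ?_ ?_
  · rintro ⟨⟨a, b⟩, ⟨⟨hal, haW⟩, hbm, hbW⟩, hab : a + b ∈ W₁⟩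
    refine ⟨mkQ_mem_redR_of_mem hal haW, mkQ_mem_redR.2 ?_⟩
    exact Submodule.mem_sup.2 ⟨-b, neg_mem ⟨hbm, hbW⟩, a + b, hab, by simp⟩
  · rintro ⟨⟨a, b⟩, ⟨⟨hal, haW⟩, hb⟩, hab : a + b ∈ W₁⟩
    exact ⟨Submodule.add_mem_sup hal hb, hab⟩
  · rintro y ⟨hl, hm⟩
    obtain ⟨a, hal, haW, rfl⟩ := exists_mkQ_eq_of_mem_redR hl
    obtain ⟨b, hb, w, hw, hbw⟩ := Submodule.mem_sup.1 (mkQ_mem_redR.1 hm)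
    refine ⟨⟨(a, -b), ⟨⟨hal, haW⟩, neg_mem hb⟩, ?_⟩, by simp⟩
    change a + -b ∈ W₁
    rwa [← hbw, add_comm b, add_neg_cancel_right]
  · rintro w ⟨hlm, hw⟩
    obtain ⟨a, hal, b, hb, rfl⟩ := Submodule.mem_sup.1 hlm
    have haW : a ∈ W₂ := (Submodule.add_mem_iff_left _ hb.2).1 (hW hw)
    exact ⟨⟨(a, b), ⟨⟨hal, haW⟩, hb⟩, hw⟩, by simp [s]⟩
  · rintro ⟨⟨a, b⟩, ⟨⟨hal, haW⟩, hbm, hbW⟩, hab : a + b ∈ W₁⟩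
    change W₁.mkQ a ∈ _ ↔ a + b ∈ _
    rw [mkQ_mem_redR]
    constructor
    · intro h
      obtain ⟨c, ⟨⟨hcl, hcm⟩, -⟩, w, hw, rfl⟩ := Submodule.mem_sup.1 h
      have hwl : w ∈ l := (Submodule.add_mem_iff_right _ hcl).1 hal
      have hcb : c + b ∈ W₁ := by
        rw [add_right_comm] at hab
        exact (Submodule.add_mem_iff_left _ hw).1 hab
      exact Submodule.mem_sup.2 ⟨w, ⟨hwl, hw⟩, c + b, ⟨add_mem hcm hbm, hcb⟩, by abel⟩
    · intro h
      obtain ⟨u, ⟨hul, huW⟩, v, ⟨hvm, -⟩, huv⟩ := Submodule.mem_sup.1 h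
      have hau : a - u = v - b := by
        rw [sub_eq_sub_iff_add_eq_add, ← huv, add_comm]
      exact Submodule.mem_sup.2 ⟨a - u,
        ⟨⟨sub_mem hal hul, hau ▸ sub_mem hvm hbm⟩, sub_mem haW (hW huW)⟩, u, huW, by abel⟩

theorem redR_equiv (W₁ W₂ V : Submodule 𝕂 X) :
    Nonempty (↥(redR W₁ W₂ V) ≃ₗ[𝕂] (↥(V ⊓ W₂) ⧸ (V ⊓ W₁).comap (V ⊓ W₂).subtype)) := by
  let f := W₁.mkQ ∘ₗ (V ⊓ W₂).subtype
  have hker : (V ⊓ W₁).comap (V ⊓ W₂).subtype = LinearMap.ker f := by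
    ext ⟨x, hx⟩
    simpa [f] using fun _ => hx.1
  have hrange : LinearMap.range f = redR W₁ W₂ V := by
    rw [LinearMap.range_comp, Submodule.range_subtype, redR_eq_map]
  exact ⟨(Submodule.quotEquivOfEq _ _ hker ≪≫ₗ f.quotKerEquivRange ≪≫ₗ
    LinearEquiv.ofEq _ _ hrange).symm⟩

theorem redR_sup_quotient_equiv (W₁ W₂ l m : Submodule 𝕂 X) :
    Nonempty
      ((↥(redR W₁ W₂ (l ⊔ m)) ⧸
          (redR W₁ W₂ l ⊔ redR W₁ W₂ m).comap (redR W₁ W₂ (l ⊔ m)).subtype) ≃ₗ[𝕂]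
        (↥(((l ⊔ m) ⊓ W₂) ⊔ W₁) ⧸
          ((l ⊓ W₂) ⊔ (m ⊓ W₂) ⊔ W₁).comap (((l ⊔ m) ⊓ W₂) ⊔ W₁).subtype)) := by
  refine nonempty_subquotient_equiv (W₁.mkQ ∘ₗ (((l ⊔ m) ⊓ W₂) ⊔ W₁).subtype)
    (((l ⊔ m) ⊓ W₂) ⊔ W₁).subtype (fun p => mkQ_mem_redR.2 p.2) (fun p => p.2) ?_
    (fun b hb => ⟨⟨b, hb⟩, by simp⟩) ?_
  · rintro _ ⟨x, hx, rfl⟩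
    exact ⟨⟨x, hx⟩, by simp⟩
  · rintro ⟨x, hx⟩
    change W₁.mkQ x ∈ _ ↔ x ∈ _
    rw [redR_eq_map, redR_eq_map, ← Submodule.map_sup, ← Submodule.mem_comap,
      Submodule.comap_map_mkQ, sup_comm W₁]

theorem redR_self_quotient_equiv {W₁ W₂ : Submodule 𝕂 X} (V : Submodule 𝕂 X) (hW : W₁ ≤ W₂) :
    Nonempty
      ((↥(redR W₁ W₂ W₂) ⧸ (redR W₁ W₂ V).comap (redR W₁ W₂ W₂).subtype) ≃ₗ[𝕂]
        (↥(V ⊔ W₂) ⧸ (V ⊔ W₁).comap (V ⊔ W₂).subtype)) := by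
  refine nonempty_subquotient_equiv (W₁.mkQ ∘ₗ W₂.subtype) W₂.subtype
    (fun p => mkQ_mem_redR_of_mem p.2 p.2) (fun p => Submodule.mem_sup_right p.2) ?_ ?_ ?_
  · intro y hy
    obtain ⟨x, hx, -, rfl⟩ := exists_mkQ_eq_of_mem_redR hy
    exact ⟨⟨x, hx⟩, by simp⟩
  · intro b hb
    obtain ⟨v, hv, w, hw, rfl⟩ := Submodule.mem_sup.1 hb
    refine ⟨⟨w, hw⟩, Submodule.mem_sup_left ?_⟩
    simpa using hv
  · rintro ⟨x, hx⟩
    change W₁.mkQ x ∈ _ ↔ x ∈ _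
    rw [mkQ_mem_redR, sup_comm, inf_comm, inf_comm W₂, ← sup_inf_assoc_of_le V hW, sup_comm,
      Submodule.mem_inf, and_iff_left hx]

end redR

/-- Generalized reduction lemma: let `X` be a vector space with subspaces `W₁ ⊆ W₂` and
`l`, `m`, and set `R(V) := ((V ∩ W₂) + W₁)/W₁`. Then:
(a) `(R(l) ∩ R(m))/R(l ∩ m) ≅ ((l + (m ∩ W₂)) ∩ W₁)/((l ∩ W₁) + (m ∩ W₁))` and
`R(l ∩ m) ≅ (l ∩ m ∩ W₂)/(l ∩ m ∩ W₁)`, and `R(l ∩ m) = R(l) ∩ R(m)` if `W₁ ⊆ m ⊆ W₂`;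
(b) `R(l + m)/(R(l) + R(m)) ≅ (((l + m) ∩ W₂) + W₁)/((l ∩ W₂) + (m ∩ W₂) + W₁)` and
`R(W₂)/R(l + m) ≅ (l + m + W₂)/(l + m + W₁)`, and `R(l + m) = R(l) + R(m)` if
`W₁ ⊆ m ⊆ W₂`. -/
theorem g_index_reduction
    {𝕂 : Type*} [Field 𝕂] {X : Type*} [AddCommGroup X] [Module 𝕂 X]
    (W₁ W₂ l m : Submodule 𝕂 X) (hW : W₁ ≤ W₂) :
    -- (a)
    Nonempty
      ((↥(redR W₁ W₂ l ⊓ redR W₁ W₂ m) ⧸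
          (redR W₁ W₂ (l ⊓ m)).comap (redR W₁ W₂ l ⊓ redR W₁ W₂ m).subtype) ≃ₗ[𝕂]
        (↥((l ⊔ (m ⊓ W₂)) ⊓ W₁) ⧸
          ((l ⊓ W₁) ⊔ (m ⊓ W₁)).comap ((l ⊔ (m ⊓ W₂)) ⊓ W₁).subtype))
    ∧ Nonempty
      (↥(redR W₁ W₂ (l ⊓ m)) ≃ₗ[𝕂]
        (↥(l ⊓ m ⊓ W₂) ⧸ (l ⊓ m ⊓ W₁).comap (l ⊓ m ⊓ W₂).subtype))
    ∧ (W₁ ≤ m → m ≤ W₂ → redR W₁ W₂ (l ⊓ m) = redR W₁ W₂ l ⊓ redR W₁ W₂ m)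
    -- (b)
    ∧ Nonempty
      ((↥(redR W₁ W₂ (l ⊔ m)) ⧸
          (redR W₁ W₂ l ⊔ redR W₁ W₂ m).comap (redR W₁ W₂ (l ⊔ m)).subtype) ≃ₗ[𝕂]
        (↥(((l ⊔ m) ⊓ W₂) ⊔ W₁) ⧸
          ((l ⊓ W₂) ⊔ (m ⊓ W₂) ⊔ W₁).comap (((l ⊔ m) ⊓ W₂) ⊔ W₁).subtype))
    ∧ Nonempty
      ((↥(redR W₁ W₂ W₂) ⧸
          (redR W₁ W₂ (l ⊔ m)).comap (redR W₁ W₂ W₂).subtype) ≃ₗ[𝕂]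
        (↥(l ⊔ m ⊔ W₂) ⧸ (l ⊔ m ⊔ W₁).comap (l ⊔ m ⊔ W₂).subtype))
    ∧ (W₁ ≤ m → m ≤ W₂ → redR W₁ W₂ (l ⊔ m) = redR W₁ W₂ l ⊔ redR W₁ W₂ m) := by
  exact ⟨redR_inf_quotient_equiv l m hW, redR_equiv W₁ W₂ (l ⊓ m), fun hm _ => redR_inf_of_le l hm,
    redR_sup_quotient_equiv W₁ W₂ l m, redR_self_quotient_equiv (l ⊔ m) hW,
    fun _ hm => redR_sup_of_le l hm⟩
end

section
/- Let (X, ω) be a symplectic vector space over 𝕂 ∈ {ℝ, ℂ}, let (λ, μ) be a Fredholm pair of Lagrangian subspaces of X of index 0, and let W₁, W₂ be linear subspaces with λ ⊆ W₁ and μ ⊆ W₂ such that W := W₁ ∩ W₂ is coisotropic. Then: (λ ∩ W^ω) + (μ ∩ W^ω) = W^ω; the symplectic reductions R_W(λ) := ((λ ∩ W) + W^ω)/W^ω and R_W(μ) := ((μ ∩ W) + W^ω)/W^ω are Lagrangian subspaces of the symplectic reduction (W/W^ω, ω̃), where ω̃(x + W^ω, y + W^ω) := ω(x, y); equivalently,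 ((λ ∩ W) + W^ω)^ω ∩ W = (λ ∩ W) + W^ω and ((μ ∩ W) + W^ω)^ω ∩ W = (μ ∩ W) + W^ω; and the pair (R_W(λ), R_W(μ)) is a Fredholm pair in W/W^ω of index 0, i.e. dim(R_W(λ) ∩ R_W(μ)) = dim((W/W^ω)/(R_W(λ) + R_W(μ))) < ∞. -/
/-- The ω-annihilator of a linear subspace:
`V^ω = {x ∈ X : ω(x, y) = 0 for all y ∈ V}`. -/
def omegaAnn {𝕂 : Type*} [Field 𝕂] {X : Type*} [AddCommGroup X] [Module 𝕂 X]
    (ω : X →ₗ[𝕂] X →ₗ[𝕂] 𝕂) (V : Submodule 𝕂 X) : Submodule 𝕂 X where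
  carrier := {x | ∀ y ∈ V, ω x y = 0}
  zero_mem' := by intro y hy; simp
  add_mem' := by
    intro a b ha hb y hy
    simp only [map_add, LinearMap.add_apply, ha y hy, hb y hy, add_zero]
  smul_mem' := by
    intro c a ha y hy
    simp only [map_smul, LinearMap.smul_apply, ha y hy, smul_zero]


section OmegaAnn

variable {𝕂 : Type*} [Field 𝕂] {X : Type*} [AddCommGroup X] [Module 𝕂 X]
  {ω : X →ₗ[𝕂] X →ₗ[𝕂] 𝕂} {l m : Submodule 𝕂 X}

theorem mem_omegaAnn {V : Submodule 𝕂 X} {x : X} :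
    x ∈ omegaAnn ω V ↔ ∀ y ∈ V, ω x y = 0 := Iff.rfl

theorem omegaAnn_anti {U V : Submodule 𝕂 X} (h : U ≤ V) : omegaAnn ω V ≤ omegaAnn ω U :=
  fun _ hx y hy => hx y (h hy)

/-- A functional vanishing on `l + m` is represented by an element of `l ∩ m`. -/
theorem exists_mem_inf_of_vanish_sup
    (hnondeg : ∀ x, (∀ y, ω x y = 0) → x = 0)
    (hl : omegaAnn ω l = l) (hm : omegaAnn ω m = m)
    [FiniteDimensional 𝕂 ↥(l ⊓ m)] [FiniteDimensional 𝕂 (X ⧸ (l ⊔ m))]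
    (hindex : Module.finrank 𝕂 ↥(l ⊓ m) = Module.finrank 𝕂 (X ⧸ (l ⊔ m)))
    {f : X →ₗ[𝕂] 𝕂} (hf : ∀ y ∈ l ⊔ m, f y = 0) : ∃ c ∈ l ⊓ m, ω c = f := by
  have hann : l ⊔ m ≤ LinearMap.ker (ω ∘ₗ (l ⊓ m).subtype).flip := by
    refine sup_le (fun y hy => LinearMap.ext fun c => ?_) (fun y hy => LinearMap.ext fun c => ?_)
    · exact (hl.ge c.2.1 : (c : X) ∈ omegaAnn ω l) y hy
    · exact (hm.ge c.2.2 : (c : X) ∈ omegaAnn ω m) y hy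
  let φ : ↥(l ⊓ m) →ₗ[𝕂] Module.Dual 𝕂 (X ⧸ (l ⊔ m)) :=
    ((l ⊔ m).liftQ (ω ∘ₗ (l ⊓ m).subtype).flip hann).flip
  have hφ : Function.Injective φ := by
    rw [injective_iff_map_eq_zero]
    intro c hc
    exact Subtype.ext (hnondeg c fun y => LinearMap.congr_fun hc ((l ⊔ m).mkQ y))
  have hdim : Module.finrank 𝕂 ↥(l ⊓ m) = Module.finrank 𝕂 (Module.Dual 𝕂 (X ⧸ (l ⊔ m))) := by
    rw [hindex, Subspace.dual_finrank_eq]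
  obtain ⟨c, hc⟩ := (LinearMap.injective_iff_surjective_of_finrank_eq_finrank hdim).1 hφ
    ((l ⊔ m).liftQ f hf)
  exact ⟨c, c.2, LinearMap.ext fun y => LinearMap.congr_fun hc ((l ⊔ m).mkQ y)⟩

theorem omegaAnn_inf_le_sup
    (hskew : ∀ x y, ω x y = - ω y x)
    (hrep : ∀ f : X →ₗ[𝕂] 𝕂, (∀ y ∈ l ⊔ m, f y = 0) → ∃ c ∈ l ⊓ m, ω c = f) :
    omegaAnn ω (l ⊓ m) ≤ l ⊔ m := by
  intro x hx
  by_contra hxlm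
  obtain ⟨f, hfx, hf⟩ := Submodule.exists_le_ker_of_notMem hxlm
  obtain ⟨c, hc, rfl⟩ := hrep f fun y hy => hf hy
  exact hfx (by rw [hskew, hx c hc, neg_zero])

theorem omegaAnn_inf_le_sup_omegaAnn
    (hskew : ∀ x y, ω x y = - ω y x)
    (hl : omegaAnn ω l = l) (hm : omegaAnn ω m = m)
    (hrep : ∀ f : X →ₗ[𝕂] 𝕂, (∀ y ∈ l ⊔ m, f y = 0) → ∃ c ∈ l ⊓ m, ω c = f)
    {V₁ V₂ : Submodule 𝕂 X} (h₁ : l ≤ V₁) (h₂ : m ≤ V₂) :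
    omegaAnn ω (V₁ ⊓ V₂) ≤ omegaAnn ω V₁ ⊔ omegaAnn ω V₂ := by
  intro x hx
  obtain ⟨a, ha, b, hb, rfl⟩ := Submodule.mem_sup.1
    (omegaAnn_inf_le_sup hskew hrep (omegaAnn_anti (inf_le_inf h₁ h₂) hx))
  have hdual : ω (a + b) ∈ V₁.dualAnnihilator ⊔ V₂.dualAnnihilator := by
    rw [← Subspace.dualAnnihilator_inf_eq, Submodule.mem_dualAnnihilator]
    exact hx
  obtain ⟨f, hf, g, hg, hfg⟩ := Submodule.mem_sup.1 hdual
  rw [Submodule.mem_dualAnnihilator] at hf hg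
  have hfg' : ∀ y, f y + g y = ω a y + ω b y := fun y => by
    simpa using LinearMap.congr_fun hfg y
  have ha' : ∀ y ∈ l, ω a y = 0 := (hl.symm ▸ ha : a ∈ omegaAnn ω l)
  have hb' : ∀ y ∈ m, ω b y = 0 := (hm.symm ▸ hb : b ∈ omegaAnn ω m)
  obtain ⟨c, -, hc⟩ := hrep (f - ω a) fun y hy => by
    obtain ⟨p, hp, q, hq, rfl⟩ := Submodule.mem_sup.1 hy
    have hq' := hfg' q
    rw [hg q (h₂ hq), hb' q hq, add_zero, add_zero] at hq'
    simp [hf p (h₁ hp), ha' p hp, hq']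
  have hc' : ∀ y, ω c y = f y - ω a y := fun y => by simp [hc]
  refine Submodule.mem_sup.2 ⟨a + c, fun y hy => ?_, b - c, fun y hy => ?_, by abel⟩
  · rw [map_add, LinearMap.add_apply, hc', hf y hy]
    ring
  · rw [map_sub, LinearMap.sub_apply, hc']
    linear_combination hg y hy - hfg' y

/-- The reduction of `l` via `W` is Lagrangian if `l ∩ V ⊆ W ⊆ V` and
`(l ∩ V)^ω ⊆ l + V^ω` for some `V`. -/
theorem omegaAnn_reduction_eq
    (hskew : ∀ x y, ω x y = - ω y x) (hl : omegaAnn ω l = l)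
    {V W : Submodule 𝕂 X} (hWV : W ≤ V) (hlV : l ⊓ V ≤ W)
    (hV : omegaAnn ω (l ⊓ V) ≤ l ⊔ omegaAnn ω V) (hcoiso : omegaAnn ω W ≤ W) :
    omegaAnn ω ((l ⊓ W) ⊔ omegaAnn ω W) ⊓ W = (l ⊓ W) ⊔ omegaAnn ω W := by
  apply le_antisymm
  · rintro x ⟨hx, hxW⟩
    have hxl : x ∈ omegaAnn ω (l ⊓ V) :=
      omegaAnn_anti (le_sup_of_le_left (le_inf inf_le_left hlV)) hx
    obtain ⟨a, ha, b, hb, rfl⟩ := Submodule.mem_sup.1 (hV hxl)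
    have hbW : b ∈ omegaAnn ω W := omegaAnn_anti hWV hb
    refine Submodule.add_mem_sup ⟨ha, ?_⟩ hbW
    simpa using W.sub_mem hxW (hcoiso hbW)
  · refine le_inf ?_ (sup_le inf_le_right hcoiso)
    intro x hx y hy
    obtain ⟨a, ha, b, hb, rfl⟩ := Submodule.mem_sup.1 hx
    obtain ⟨c, hc, d, hd, rfl⟩ := Submodule.mem_sup.1 hy
    have hac : ω a c = 0 := (hl.symm ▸ ha.1 : a ∈ omegaAnn ω l) c hc.1
    have had : ω a d = 0 := by rw [hskew, hd a ha.2, neg_zero]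
    simp [hac, had, hb c hc.2, hb d (hcoiso hd)]

end OmegaAnn

theorem finrank_quotient_le_of_pairing {𝕂 S T : Type*} [Field 𝕂] [AddCommGroup S] [Module 𝕂 S]
    [AddCommGroup T] [Module 𝕂 T] (β : S →ₗ[𝕂] T →ₗ[𝕂] 𝕂)
    {S' : Submodule 𝕂 S} {T' : Submodule 𝕂 T}
    (hS : ∀ s, s ∈ S' ↔ ∀ t, β s t = 0) (hT : ∀ t ∈ T', ∀ s, β s t = 0)
    [FiniteDimensional 𝕂 (T ⧸ T')] :
    FiniteDimensional 𝕂 (S ⧸ S') ∧ Module.finrank 𝕂 (S ⧸ S') ≤ Module.finrank 𝕂 (T ⧸ T') := by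
  have hT' : T' ≤ LinearMap.ker β.flip := fun t ht => LinearMap.ext (hT t ht)
  let γ : S →ₗ[𝕂] Module.Dual 𝕂 (T ⧸ T') := (T'.liftQ β.flip hT').flip
  have hker : LinearMap.ker γ = S' := by
    ext s
    rw [hS, LinearMap.mem_ker]
    exact ⟨fun h t => LinearMap.congr_fun h (T'.mkQ t),
      fun h => Submodule.linearMap_qext _ (LinearMap.ext h)⟩
  have hinj : Function.Injective (S'.liftQ γ hker.ge) :=
    LinearMap.ker_eq_bot.1 (Submodule.ker_liftQ_eq_bot _ _ _ hker.le)
  refine ⟨FiniteDimensional.of_injective _ hinj, ?_⟩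
  simpa only [Subspace.dual_finrank_eq] using LinearMap.finrank_le_finrank_of_injective hinj

/-- The quotients by the two kernels of a bilinear pairing have the same dimension. -/
theorem finrank_quotient_eq_of_pairing {𝕂 S T : Type*} [Field 𝕂] [AddCommGroup S] [Module 𝕂 S]
    [AddCommGroup T] [Module 𝕂 T] (β : S →ₗ[𝕂] T →ₗ[𝕂] 𝕂)
    {S' : Submodule 𝕂 S} {T' : Submodule 𝕂 T}
    (hS : ∀ s, s ∈ S' ↔ ∀ t, β s t = 0) (hT : ∀ t, t ∈ T' ↔ ∀ s, β s t = 0)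
    [FiniteDimensional 𝕂 (T ⧸ T')] :
    FiniteDimensional 𝕂 (S ⧸ S') ∧ Module.finrank 𝕂 (S ⧸ S') = Module.finrank 𝕂 (T ⧸ T') := by
  obtain ⟨hfin, hle⟩ := finrank_quotient_le_of_pairing β hS fun t ht => (hT t).1 ht
  exact ⟨hfin, hle.antisymm
    (finrank_quotient_le_of_pairing β.flip hT fun s hs => (hS s).1 hs).2⟩

/-- Let `(X, ω)` be a symplectic vector space over `𝕂 ∈ {ℝ, ℂ}`, `(l, m)` a Fredholm pair of
Lagrangian subspaces of index `0`, and `W₁ ⊇ l`, `W₂ ⊇ m` subspaces such that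
`W := W₁ ∩ W₂` is coisotropic. Then `(l ∩ W^ω) + (m ∩ W^ω) = W^ω`; the symplectic
reductions `R_W(l) = ((l ∩ W) + W^ω)/W^ω` and `R_W(m)` are Lagrangian subspaces of
`W/W^ω` — equivalently (as stated here) `((l ∩ W) + W^ω)^ω ∩ W = (l ∩ W) + W^ω` and
`((m ∩ W) + W^ω)^ω ∩ W = (m ∩ W) + W^ω`; and the pair `(R_W(l), R_W(m))` is a Fredholm
pair in `W/W^ω` of index `0`, i.e.
`dim (R_W(l) ∩ R_W(m)) = dim ((W/W^ω)/(R_W(l) + R_W(m))) < ∞`, where these spaces are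
realized as `(((l ∩ W) + W^ω) ∩ ((m ∩ W) + W^ω))/W^ω` and
`W/((l ∩ W) + (m ∩ W) + W^ω)` respectively. -/
theorem lagrange_preserved_reduction
    {𝕂 : Type*} [RCLike 𝕂] {X : Type*} [AddCommGroup X] [Module 𝕂 X]
    (ω : X →ₗ[𝕂] X →ₗ[𝕂] 𝕂)
    (hskew : ∀ x y, ω x y = - ω y x)
    (hnondeg : ∀ x, (∀ y, ω x y = 0) → x = 0)
    (l m : Submodule 𝕂 X)
    (hl : omegaAnn ω l = l) (hm : omegaAnn ω m = m)
    (hfin₁ : FiniteDimensional 𝕂 ↥(l ⊓ m))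
    (hfin₂ : FiniteDimensional 𝕂 (X ⧸ (l ⊔ m)))
    (hindex : Module.finrank 𝕂 ↥(l ⊓ m) = Module.finrank 𝕂 (X ⧸ (l ⊔ m)))
    (W₁ W₂ : Submodule 𝕂 X) (hlW : l ≤ W₁) (hmW : m ≤ W₂)
    (W : Submodule 𝕂 X) (hW : W = W₁ ⊓ W₂)
    (hcoiso : omegaAnn ω W ≤ W) :
    (l ⊓ omegaAnn ω W) ⊔ (m ⊓ omegaAnn ω W) = omegaAnn ω W
      ∧ omegaAnn ω ((l ⊓ W) ⊔ omegaAnn ω W) ⊓ W = (l ⊓ W) ⊔ omegaAnn ω W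
      ∧ omegaAnn ω ((m ⊓ W) ⊔ omegaAnn ω W) ⊓ W = (m ⊓ W) ⊔ omegaAnn ω W
      ∧ FiniteDimensional 𝕂
          (↥(((l ⊓ W) ⊔ omegaAnn ω W) ⊓ ((m ⊓ W) ⊔ omegaAnn ω W)) ⧸
            (omegaAnn ω W).comap (((l ⊓ W) ⊔ omegaAnn ω W) ⊓ ((m ⊓ W) ⊔ omegaAnn ω W)).subtype)
      ∧ FiniteDimensional 𝕂
          (↥W ⧸ ((l ⊓ W) ⊔ (m ⊓ W) ⊔ omegaAnn ω W).comap W.subtype)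
      ∧ Module.finrank 𝕂
          (↥(((l ⊓ W) ⊔ omegaAnn ω W) ⊓ ((m ⊓ W) ⊔ omegaAnn ω W)) ⧸
            (omegaAnn ω W).comap (((l ⊓ W) ⊔ omegaAnn ω W) ⊓ ((m ⊓ W) ⊔ omegaAnn ω W)).subtype)
          = Module.finrank 𝕂
              (↥W ⧸ ((l ⊓ W) ⊔ (m ⊓ W) ⊔ omegaAnn ω W).comap W.subtype) := by
  have hrep : ∀ f : X →ₗ[𝕂] 𝕂, (∀ y ∈ l ⊔ m, f y = 0) → ∃ c ∈ l ⊓ m, ω c = f :=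
    fun f hf => exists_mem_inf_of_vanish_sup hnondeg hl hm hindex hf
  have hWW₁ : W ≤ W₁ := hW.trans_le inf_le_left
  have hWW₂ : W ≤ W₂ := hW.trans_le inf_le_right
  have hlmW : l ⊓ m ≤ W := hW ▸ inf_le_inf hlW hmW
  have hann₁ : omegaAnn ω W₁ ≤ l ⊓ omegaAnn ω W :=
    le_inf ((omegaAnn_anti hlW).trans hl.le) (omegaAnn_anti hWW₁)
  have hann₂ : omegaAnn ω W₂ ≤ m ⊓ omegaAnn ω W :=
    le_inf ((omegaAnn_anti hmW).trans hm.le) (omegaAnn_anti hWW₂)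
  have hsplit : (l ⊓ omegaAnn ω W) ⊔ (m ⊓ omegaAnn ω W) = omegaAnn ω W := by
    refine le_antisymm (sup_le inf_le_right inf_le_right) ?_
    calc omegaAnn ω W = omegaAnn ω (W₁ ⊓ W₂) := by rw [hW]
      _ ≤ omegaAnn ω W₁ ⊔ omegaAnn ω W₂ :=
        omegaAnn_inf_le_sup_omegaAnn hskew hl hm hrep hlW hmW
      _ ≤ _ := sup_le_sup hann₁ hann₂
  have hredl : omegaAnn ω ((l ⊓ W) ⊔ omegaAnn ω W) ⊓ W = (l ⊓ W) ⊔ omegaAnn ω W := by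
    refine omegaAnn_reduction_eq hskew hl hWW₂ (hW ▸ inf_le_inf_right _ hlW) ?_ hcoiso
    simpa only [hl] using omegaAnn_inf_le_sup_omegaAnn hskew hl hm hrep le_rfl hmW
  have hredm : omegaAnn ω ((m ⊓ W) ⊔ omegaAnn ω W) ⊓ W = (m ⊓ W) ⊔ omegaAnn ω W := by
    refine omegaAnn_reduction_eq hskew hm hWW₁
      (hW ▸ inf_comm W₁ W₂ ▸ inf_le_inf_right _ hmW) ?_ hcoiso
    simpa only [hm, inf_comm, sup_comm] using
      omegaAnn_inf_le_sup_omegaAnn hskew hl hm hrep hlW le_rfl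
  have hsup : ∀ w ∈ W, w ∈ l ⊔ m → w ∈ (l ⊓ W) ⊔ (m ⊓ W) ⊔ omegaAnn ω W := by
    intro w hw hwlm
    obtain ⟨a, ha, b, hb, rfl⟩ := Submodule.mem_sup.1 hwlm
    have ha₂ : a ∈ W₂ := by simpa using W₂.sub_mem (hWW₂ hw) (hmW hb)
    have hb₁ : b ∈ W₁ := by simpa using W₁.sub_mem (hWW₁ hw) (hlW ha)
    rw [hW] at *
    exact Submodule.mem_sup_left
      (Submodule.add_mem_sup ⟨ha, hlW ha, ha₂⟩ ⟨hb, hb₁, hmW hb⟩)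
  have hfinQ : FiniteDimensional 𝕂
      (↥W ⧸ ((l ⊓ W) ⊔ (m ⊓ W) ⊔ omegaAnn ω W).comap W.subtype) := by
    have : FiniteDimensional 𝕂 (↥W ⧸ (l ⊔ m).comap W.subtype) :=
      FiniteDimensional.of_injective (Submodule.mapQ _ (l ⊔ m) W.subtype le_rfl)
        (LinearMap.ker_eq_bot.1 (by rw [Submodule.ker_mapQ, Submodule.mkQ_map_self]))
    have hcomap : (l ⊔ m).comap W.subtype ≤
        ((l ⊓ W) ⊔ (m ⊓ W) ⊔ omegaAnn ω W).comap W.subtype := fun w hw => hsup w w.2 hw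
    exact Module.Finite.of_surjective
      (Submodule.factor hcomap) (Submodule.factor_surjective hcomap)
  obtain ⟨hfinP, hrank⟩ := finrank_quotient_eq_of_pairing
    (ω.domRestrict₁₂ (((l ⊓ W) ⊔ omegaAnn ω W) ⊓ ((m ⊓ W) ⊔ omegaAnn ω W)) W)
    (S' := (omegaAnn ω W).comap
      (((l ⊓ W) ⊔ omegaAnn ω W) ⊓ ((m ⊓ W) ⊔ omegaAnn ω W)).subtype)
    (T' := ((l ⊓ W) ⊔ (m ⊓ W) ⊔ omegaAnn ω W).comap W.subtype)
    (fun s => ⟨fun hs t => hs t t.2, fun hs t ht => hs ⟨t, ht⟩⟩)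
    (fun w => by
      constructor
      · rintro hw ⟨s, hsl, hsm⟩
        have hsl' := (hredl.ge hsl).1
        have hsm' := (hredm.ge hsm).1
        obtain ⟨p, hp, d, hd, hpd⟩ := Submodule.mem_sup.1 hw
        obtain ⟨a, ha, b, hb, rfl⟩ := Submodule.mem_sup.1 hp
        change ω s (W.subtype w) = 0
        rw [← hpd, map_add, map_add, hsl' a (Submodule.mem_sup_left ha),
          hsm' b (Submodule.mem_sup_left hb), hsl' d (Submodule.mem_sup_right hd)]
        simp
      · intro hw
        refine hsup w w.2 (omegaAnn_inf_le_sup hskew hrep fun c hc => ?_)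
        rw [hskew, neg_eq_zero]
        exact hw ⟨c, Submodule.mem_sup_left ⟨hc.1, hlmW hc⟩,
          Submodule.mem_sup_left ⟨hc.2, hlmW hc⟩⟩)
  exact ⟨hsplit, hredl, hredm, hfinP, hfinQ, hrank⟩
end
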